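/- The map ⟨NE⟩ satisfies the Yang–Baxter equation: (⟨NE⟩ ⊗ id_V) ∘ (id_V ⊗ ⟨NE⟩) ∘ (⟨NE⟩ ⊗ id_V) = (id_V ⊗ ⟨NE⟩) ∘ (⟨NE⟩ ⊗ id_V) ∘ (id_V ⊗ ⟨NE⟩) as K-linear maps V ⊗ V ⊗ V → V ⊗ V ⊗ V. This is the Kauffman-amplitude identity for the all-NE flavor of the third Reidemeister move (the elementary transition ET3bmt). -/

import Mathlib

set_option synthInstance.maxHeartbeats 1000000
set_option maxHeartbeats 1000000

noncomputable section

open TensorProduct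

/-- The ground field `K = ℚ(q)`. -/
abbrev K : Type := RatFunc ℚ

/-- The 2-dimensional `K`-vector space `V` with basis `e 0, e 1`. -/
abbrev V : Type := Fin 2 → K

/-- The indeterminate `q`. -/
noncomputable def q : K := RatFunc.X

/-- The basis vectors `e₀, e₁` of `V`. -/
noncomputable def e : Fin 2 → V := fun i => Pi.single i (1 : K)

/-- The standard basis of `V`. -/
noncomputable def Vbasis : Module.Basis (Fin 2) K V := Pi.basisFun K (Fin 2)

/-- The induced basis `e i ⊗ e j` of `V ⊗ V`. -/
noncomputable def VVbasis : Module.Basis (Fin 2 × Fin 2) K (V ⊗[K] V) :=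
  Vbasis.tensorProduct Vbasis

/-- Kauffman amplitude of `Cup`: `1 ↦ -q·e₀⊗e₁ + q⁻¹·e₁⊗e₀`. -/
noncomputable def Cup : K →ₗ[K] V ⊗[K] V :=
  LinearMap.toSpanSingleton K (V ⊗[K] V)
    ((-q) • (e 0 ⊗ₜ[K] e 1) + q⁻¹ • (e 1 ⊗ₜ[K] e 0))

/-- Kauffman amplitude of `Cap`: `e₀⊗e₀ ↦ 0`, `e₁⊗e₁ ↦ 0`, `e₀⊗e₁ ↦ q`, `e₁⊗e₀ ↦ -q⁻¹`. -/
noncomputable def Cap : V ⊗[K] V →ₗ[K] K :=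
  VVbasis.constr K fun p =>
    if p = (0, 1) then q else if p = (1, 0) then -q⁻¹ else 0

/-- Kauffman amplitude of `NE`. -/
noncomputable def NE : V ⊗[K] V →ₗ[K] V ⊗[K] V :=
  VVbasis.constr K fun p =>
    if p = (0, 0) then q • (e 0 ⊗ₜ[K] e 0)
    else if p = (1, 1) then q • (e 1 ⊗ₜ[K] e 1)
    else if p = (0, 1) then q⁻¹ • (e 1 ⊗ₜ[K] e 0)
    else q⁻¹ • (e 0 ⊗ₜ[K] e 1) + (q - q⁻¹ ^ 3) • (e 1 ⊗ₜ[K] e 0)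

/-- Kauffman amplitude of `NW`. -/
noncomputable def NW : V ⊗[K] V →ₗ[K] V ⊗[K] V :=
  VVbasis.constr K fun p =>
    if p = (0, 0) then q⁻¹ • (e 0 ⊗ₜ[K] e 0)
    else if p = (1, 1) then q⁻¹ • (e 1 ⊗ₜ[K] e 1)
    else if p = (1, 0) then q • (e 0 ⊗ₜ[K] e 1)
    else (q⁻¹ - q ^ 3) • (e 0 ⊗ₜ[K] e 1) + q • (e 1 ⊗ₜ[K] e 0)

/-- `f ⊗ id_V` acting on the first two factors of `(V ⊗ V) ⊗ V`. -/
noncomputable def lowCross (f : V ⊗[K] V →ₗ[K] V ⊗[K] V) :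
    (V ⊗[K] V) ⊗[K] V →ₗ[K] (V ⊗[K] V) ⊗[K] V :=
  TensorProduct.map f LinearMap.id

/-- `id_V ⊗ f` acting on the last two factors of `(V ⊗ V) ⊗ V`. -/
noncomputable def highCross (f : V ⊗[K] V →ₗ[K] V ⊗[K] V) :
    (V ⊗[K] V) ⊗[K] V →ₗ[K] (V ⊗[K] V) ⊗[K] V :=
  (TensorProduct.assoc K V V V).symm.toLinearMap ∘ₗ
    TensorProduct.map LinearMap.id f ∘ₗ (TensorProduct.assoc K V V V).toLinearMap

theorem NE_e (i j : Fin 2) : NE (e i ⊗ₜ[K] e j) =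
    if (i, j) = (0, 0) then q • (e 0 ⊗ₜ[K] e 0)
    else if (i, j) = (1, 1) then q • (e 1 ⊗ₜ[K] e 1)
    else if (i, j) = (0, 1) then q⁻¹ • (e 1 ⊗ₜ[K] e 0)
    else q⁻¹ • (e 0 ⊗ₜ[K] e 1) + (q - q⁻¹ ^ 3) • (e 1 ⊗ₜ[K] e 0) := by
  have h : e i ⊗ₜ[K] e j = VVbasis (i, j) := by
    simp [VVbasis, Vbasis, e, Module.Basis.tensorProduct_apply]
  rw [h, NE, Module.Basis.constr_basis]

theorem NE_00 : NE (e 0 ⊗ₜ[K] e 0) = q • (e 0 ⊗ₜ[K] e 0) := by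
  rw [NE_e, if_pos (by decide)]

theorem NE_11 : NE (e 1 ⊗ₜ[K] e 1) = q • (e 1 ⊗ₜ[K] e 1) := by
  rw [NE_e, if_neg (by decide), if_pos (by decide)]

theorem NE_01 : NE (e 0 ⊗ₜ[K] e 1) = q⁻¹ • (e 1 ⊗ₜ[K] e 0) := by
  rw [NE_e, if_neg (by decide), if_neg (by decide), if_pos (by decide)]

theorem NE_10 : NE (e 1 ⊗ₜ[K] e 0) =
    q⁻¹ • (e 0 ⊗ₜ[K] e 1) + (q - q⁻¹ ^ 3) • (e 1 ⊗ₜ[K] e 0) := by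
  rw [NE_e, if_neg (by decide), if_neg (by decide), if_neg (by decide)]

theorem low_apply (f : V ⊗[K] V →ₗ[K] V ⊗[K] V) (x y z : V) :
    lowCross f ((x ⊗ₜ[K] y) ⊗ₜ[K] z) = f (x ⊗ₜ[K] y) ⊗ₜ[K] z := rfl

theorem high_apply (f : V ⊗[K] V →ₗ[K] V ⊗[K] V) (x y z : V) :
    highCross f ((x ⊗ₜ[K] y) ⊗ₜ[K] z) =
      (TensorProduct.assoc K V V V).symm (x ⊗ₜ[K] f (y ⊗ₜ[K] z)) := rfl

/-- The Yang-Baxter computation for operators acting on an abstract family of vectors. -/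
theorem yb_abstract {F M : Type*} [CommRing F] [AddCommGroup M] [Module F M]
    (L H : M →ₗ[F] M) (b : Fin 2 → Fin 2 → Fin 2 → M) (a r : F) (hq : a * r = 1)
    (hL00 : ∀ k, L (b 0 0 k) = a • b 0 0 k)
    (hL11 : ∀ k, L (b 1 1 k) = a • b 1 1 k)
    (hL01 : ∀ k, L (b 0 1 k) = r • b 1 0 k)
    (hL10 : ∀ k, L (b 1 0 k) = r • b 0 1 k + (a - r ^ 3) • b 1 0 k)
    (hH00 : ∀ k, H (b k 0 0) = a • b k 0 0)
    (hH11 : ∀ k, H (b k 1 1) = a • b k 1 1)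
    (hH01 : ∀ k, H (b k 0 1) = r • b k 1 0)
    (hH10 : ∀ k, H (b k 1 0) = r • b k 0 1 + (a - r ^ 3) • b k 1 0)
    (i j k : Fin 2) : L (H (L (b i j k))) = H (L (H (b i j k))) := by
  fin_cases i <;> fin_cases j <;> fin_cases k <;>
    simp only [Fin.zero_eta, Fin.mk_one, hL00, hL01, hL10, hL11, hH00, hH01, hH10, hH11,
      map_add, map_smul] <;>
    match_scalars <;> grind

theorem q_ne : q ≠ 0 := RatFunc.X_ne_zero

/-- Yang–Baxter equation for `⟨NE⟩` (Reidemeister III, flavor ET3bmt). -/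
theorem yang_baxter_NE :
    lowCross NE ∘ₗ highCross NE ∘ₗ lowCross NE =
      highCross NE ∘ₗ lowCross NE ∘ₗ highCross NE := by
  apply (VVbasis.tensorProduct Vbasis).ext
  rintro ⟨⟨i, j⟩, k⟩
  have hb : (VVbasis.tensorProduct Vbasis) ((i, j), k) = (e i ⊗ₜ[K] e j) ⊗ₜ[K] e k := by
    simp [VVbasis, Vbasis, e, Module.Basis.tensorProduct_apply]
  rw [hb]
  simp only [LinearMap.comp_apply]
  refine yb_abstract (lowCross NE) (highCross NE) (fun i j k => (e i ⊗ₜ[K] e j) ⊗ₜ[K] e k)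
    q q⁻¹ (mul_inv_cancel₀ q_ne) ?_ ?_ ?_ ?_ ?_ ?_ ?_ ?_ i j k <;> intro k <;>
    simp only [low_apply, high_apply, NE_00, NE_01, NE_10, NE_11, map_add, map_smul,
      TensorProduct.add_tmul, TensorProduct.tmul_add, TensorProduct.tmul_smul,
      TensorProduct.assoc_symm_tmul, ← TensorProduct.smul_tmul']
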